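/- Let X be a finite set with N := #X ≥ 2 and let ε > 0. Then L(ε) is exponentially C-generic, where C denotes the set of cyclically reduced elements of F(X). -/

import Mathlib

/-! Common definitions: cyclic length, Whitehead automorphisms, the sets TS, TS', L(ε),
balls, and exponential genericity in the free group F(X). -/

/-- The cyclic length ‖w‖_X : the minimum of |g w g⁻¹|_X over g ∈ F(X). -/
noncomputable def cyclicLength {X : Type} [DecidableEq X] (w : FreeGroup X) : ℕ :=
  sInf (Set.range fun g : FreeGroup X => FreeGroup.norm (g * w * g⁻¹))

/-- w is cyclically reduced if |w|_X = ‖w‖_X. -/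
def CyclicallyReduced {X : Type} [DecidableEq X] (w : FreeGroup X) : Prop :=
  FreeGroup.norm w = cyclicLength w

/-- The set X^± = X ∪ X⁻¹ of letters, viewed inside F(X). -/
def Xpm (X : Type) : Set (FreeGroup X) :=
  (Set.range fun x : X => FreeGroup.of x) ∪ (Set.range fun x : X => (FreeGroup.of x)⁻¹)

/-- σ is a type I (relabeling) Whitehead automorphism: there is a bijection π of X^±
commuting with inversion such that σ(x) = π(x) for all x ∈ X. -/
def IsTypeI {X : Type} (σ : MulAut (FreeGroup X)) : Prop :=
  ∃ π : FreeGroup X → FreeGroup X,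
    Set.BijOn π (Xpm X) (Xpm X) ∧
    (∀ x ∈ Xpm X, π x⁻¹ = (π x)⁻¹) ∧
    (∀ x : X, σ (FreeGroup.of x) = π (FreeGroup.of x))

/-- σ is a type II Whitehead automorphism: there is a ∈ X^± with σ(a) = a and
σ(x) ∈ {x, xa, a⁻¹x, a⁻¹xa} for every x ∈ X^±. -/
def IsTypeII {X : Type} (σ : MulAut (FreeGroup X)) : Prop :=
  ∃ a ∈ Xpm X, σ a = a ∧
    ∀ x ∈ Xpm X, σ x = x ∨ σ x = x * a ∨ σ x = a⁻¹ * x ∨ σ x = a⁻¹ * x * a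

/-- σ is inner if it is conjugation by some element of F(X). -/
def IsInnerAut {X : Type} (σ : MulAut (FreeGroup X)) : Prop :=
  ∃ g : FreeGroup X, σ = MulAut.conj g

/-- w is a proper power if w = z^r for some z and some integer r ≥ 2. -/
def IsProperPower {X : Type} (w : FreeGroup X) : Prop :=
  ∃ z : FreeGroup X, ∃ r : ℕ, 2 ≤ r ∧ w = z ^ r

/-- TS is the set of cyclically reduced w that are not proper powers, whose cyclic length
is strictly increased by every non-inner type II Whitehead automorphism, and whose
conjugacy class is fixed by no non-identity type I Whitehead automorphism. -/
def TS (X : Type) [DecidableEq X] : Set (FreeGroup X) :=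
  {w | CyclicallyReduced w ∧ ¬ IsProperPower w ∧
    (∀ τ : MulAut (FreeGroup X), IsTypeII τ → ¬ IsInnerAut τ →
      cyclicLength w < cyclicLength (τ w)) ∧
    (∀ σ : MulAut (FreeGroup X), IsTypeI σ → σ ≠ 1 → ¬ IsConj w (σ w))}

/-- The set of elements of F(X) whose cyclic reduction lies in S. -/
def cyclicPreimage {X : Type} [DecidableEq X] (S : Set (FreeGroup X)) : Set (FreeGroup X) :=
  {w | ∃ g u : FreeGroup X, u ∈ S ∧ CyclicallyReduced u ∧ w = g * u * g⁻¹ ∧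
    FreeGroup.norm w = 2 * FreeGroup.norm g + FreeGroup.norm u}

/-- TS' is the set of elements of F(X) whose cyclic reduction lies in TS. -/
def TS' (X : Type) [DecidableEq X] : Set (FreeGroup X) :=
  cyclicPreimage (TS X)

/-- The ball B_n = {w ∈ F(X) : |w|_X ≤ n}. -/
def ballF (X : Type) [DecidableEq X] (n : ℕ) : Set (FreeGroup X) :=
  {w | FreeGroup.norm w ≤ n}

/-- S is exponentially T-generic: there are C > 0 and s ∈ (0,1) with
#((T∖S) ∩ B_n) ≤ C·s^n·#(T ∩ B_n) for all n. -/
def ExpGeneric {X : Type} [DecidableEq X] (S T : Set (FreeGroup X)) : Prop :=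
  ∃ C : ℝ, 0 < C ∧ ∃ s : ℝ, 0 < s ∧ s < 1 ∧
    ∀ n : ℕ, (((T \ S) ∩ ballF X n).ncard : ℝ) ≤ C * s ^ n * ((T ∩ ballF X n).ncard : ℝ)

/-- L(ε): the set of cyclically reduced w of length n ≥ 1 all of whose one-letter
frequencies lie in (1/(2N) − ε, 1/(2N) + ε) and all of whose cyclic two-letter
frequencies (for y ≠ x⁻¹) lie in (1/(2N(2N−1)) − ε, 1/(2N(2N−1)) + ε). -/
def Lset (X : Type) [Fintype X] [DecidableEq X] (ε : ℝ) : Set (FreeGroup X) :=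
  {w | CyclicallyReduced w ∧ 1 ≤ FreeGroup.norm w ∧
    ∀ x y : X × Bool, y ≠ (x.1, !x.2) →
      |((w.toWord.count x : ℝ) / (FreeGroup.norm w : ℝ)) -
        1 / (2 * (Fintype.card X : ℝ))| < ε ∧
      |(((w.toWord.zip (w.toWord.rotate 1)).count (x, y) : ℝ) / (FreeGroup.norm w : ℝ)) -
        1 / (2 * (Fintype.card X : ℝ) * (2 * (Fintype.card X : ℝ) - 1))| < ε}

section Chains

variable {A : Type*} [Fintype A] [DecidableEq A] (r : A → A → Prop) [DecidableRel r]

/-- The lists `l` of length `n` such that `x :: l` is a chain for `r`. -/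
def chainsFrom : ℕ → A → Finset (List A)
  | 0, _ => {[]}
  | n + 1, x => {y | r x y}.toFinset.biUnion fun y => (chainsFrom n y).image (List.cons y)

theorem mem_chainsFrom {n : ℕ} {x : A} {l : List A} :
    l ∈ chainsFrom r n x ↔ l.length = n ∧ (x :: l).IsChain r := by
  induction n generalizing x l with
  | zero => cases l <;> simp [chainsFrom]
  | succ n ih =>
    cases l with
    | nil => simp [chainsFrom]
    | cons y l => simp [chainsFrom, ih, List.isChain_cons_cons]; tauto

theorem sum_chainsFrom_succ (n : ℕ) (x : A) (g : List A → ℝ) :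
    ∑ l ∈ chainsFrom r (n + 1) x, g l =
      ∑ y with r x y, ∑ l ∈ chainsFrom r n y, g (y :: l) := by
  rw [chainsFrom, Finset.sum_biUnion]
  · refine Finset.sum_congr (by ext; simp) fun y _ => ?_
    rw [Finset.sum_image fun _ _ _ _ h => (List.cons.inj h).2]
  · intro y _ z _ hyz
    simp only [Function.onFun, Finset.disjoint_left, Finset.mem_image]
    rintro _ ⟨l, -, rfl⟩ ⟨l', -, h⟩
    exact hyz (List.cons.inj h).1.symm

variable {r} in
theorem card_chainsFrom {q : ℕ} (hq : ∀ x, (Finset.univ.filter (r x)).card = q) (n : ℕ) (x : A) :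
    (chainsFrom r n x).card = q ^ n := by
  induction n generalizing x with
  | zero => simp [chainsFrom]
  | succ n ih =>
    have h := sum_chainsFrom_succ r n x fun _ => 1
    simp only [Finset.sum_const, nsmul_eq_mul, mul_one, ih, hq] at h
    rw [pow_succ']
    exact_mod_cast h

/-- The sum of `f` over the consecutive pairs of the word `x :: l ++ [z]`. -/
def closeSum (f : A → A → ℝ) (z x : A) (l : List A) : ℝ :=
  (((x :: l).zip (l ++ [z])).map fun p => f p.1 p.2).sum

omit [Fintype A] [DecidableEq A] in
theorem closeSum_nil (f : A → A → ℝ) (z x : A) : closeSum f z x [] = f x z := by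
  simp [closeSum]

omit [Fintype A] [DecidableEq A] in
theorem closeSum_cons (f : A → A → ℝ) (z x y : A) (l : List A) :
    closeSum f z x (y :: l) = f x y + closeSum f z y l := by
  simp [closeSum]

omit [Fintype A] [DecidableEq A] in
theorem closeSum_neg (f : A → A → ℝ) (z x : A) (l : List A) :
    closeSum (fun u v => -f u v) z x l = -closeSum f z x l := by
  induction l generalizing x with
  | nil => simp [closeSum_nil]
  | cons y l ih => simp only [closeSum_cons, ih]; ring

omit [Fintype A] [DecidableEq A] in
theorem closeSum_coboundary (f : A → A → ℝ) (h : A → ℝ) (z x : A) (l : List A) :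
    closeSum (fun u v => f u v + h v - h u) z x l = closeSum f z x l + h z - h x := by
  induction l generalizing x with
  | nil => simp [closeSum_nil]
  | cons y l ih => simp only [closeSum_cons, ih]; ring

theorem Real.exp_le_one_add_add_sq {u : ℝ} (hu : |u| ≤ 1) : Real.exp u ≤ 1 + u + u ^ 2 := by
  linarith [(abs_le.1 (Real.abs_exp_sub_one_sub_id_le hu)).2]

variable {r}

theorem sum_exp_closeSum_le {q : ℕ} (hq : ∀ x, (Finset.univ.filter (r x)).card = q)
    {D : A → A → ℝ} {M t : ℝ} (ht : 0 ≤ t) (htM : t * M ≤ 1) (hD : ∀ x y, |D x y| ≤ M)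
    (hmean : ∀ x, ∑ y with r x y, D x y = 0) (n : ℕ) (z x : A) :
    ∑ l ∈ chainsFrom r n x, Real.exp (t * closeSum D z x l) ≤
      Real.exp (t * M) * (q * (1 + t ^ 2 * M ^ 2)) ^ n := by
  induction n generalizing x with
  | zero =>
    simp only [chainsFrom, Finset.sum_singleton, closeSum_nil, pow_zero, mul_one]
    gcongr
    exact (abs_le.1 (hD x z)).2
  | succ n ih =>
    have key : ∑ y with r x y, Real.exp (t * D x y) ≤ q * (1 + t ^ 2 * M ^ 2) := by
      calc ∑ y with r x y, Real.exp (t * D x y)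
          ≤ ∑ y with r x y, (1 + t * D x y + t ^ 2 * M ^ 2) := by
            refine Finset.sum_le_sum fun y _ => ?_
            have h1 : |t * D x y| ≤ t * M := by
              rw [abs_mul, abs_of_nonneg ht]; exact mul_le_mul_of_nonneg_left (hD x y) ht
            refine (Real.exp_le_one_add_add_sq (h1.trans htM)).trans ?_
            have h2 : (t * D x y) ^ 2 ≤ (t * M) ^ 2 := sq_le_sq' (abs_le.1 h1).1 (abs_le.1 h1).2
            linarith [mul_pow t M 2]
        _ = q * (1 + t ^ 2 * M ^ 2) := by
            rw [Finset.sum_add_distrib, Finset.sum_add_distrib, ← Finset.mul_sum, hmean]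
            simp only [Finset.sum_const, hq, nsmul_eq_mul]
            ring
    rw [sum_chainsFrom_succ]
    calc ∑ y with r x y, ∑ l ∈ chainsFrom r n y, Real.exp (t * closeSum D z x (y :: l))
        = ∑ y with r x y, Real.exp (t * D x y) *
            ∑ l ∈ chainsFrom r n y, Real.exp (t * closeSum D z y l) := by
          refine Finset.sum_congr rfl fun y _ => ?_
          rw [Finset.mul_sum]
          exact Finset.sum_congr rfl fun l _ => by rw [closeSum_cons, mul_add, Real.exp_add]
      _ ≤ ∑ y with r x y, Real.exp (t * D x y) *
            (Real.exp (t * M) * (q * (1 + t ^ 2 * M ^ 2)) ^ n) := by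
          gcongr with y _
          exact ih y
      _ = (∑ y with r x y, Real.exp (t * D x y)) *
            (Real.exp (t * M) * (q * (1 + t ^ 2 * M ^ 2)) ^ n) := by rw [Finset.sum_mul]
      _ ≤ (q * (1 + t ^ 2 * M ^ 2)) * (Real.exp (t * M) * (q * (1 + t ^ 2 * M ^ 2)) ^ n) := by
          gcongr
      _ = _ := by ring

/-- A large deviation bound for cyclic sums along chains, for functions which have mean zero
up to a coboundary; the constants depend only on a bound for the corrected function. -/
theorem exists_card_closeSum_le {q : ℕ} (hq : ∀ x, (Finset.univ.filter (r x)).card = q)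
    {M ε : ℝ} (hM : 1 ≤ M) (hε : 0 < ε) :
    ∃ C : ℝ, 0 < C ∧ ∃ s : ℝ, 1 / 2 ≤ s ∧ s < 1 ∧ ∀ (f : A → A → ℝ) (h : A → ℝ),
      (∀ x y, |f x y + h y - h x| ≤ M) → (∀ x, ∑ y with r x y, (f x y + h y - h x) = 0) →
      ∀ n x, (((chainsFrom r n x).filter fun l => ε * (n + 1) ≤ closeSum f x x l).card : ℝ) ≤
        C * (q * s) ^ n := by
  set t : ℝ := ε / (M ^ 2 * (1 + ε)) with ht
  have ht0 : 0 < t := by positivity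
  have htM2 : t * M ^ 2 = ε / (1 + ε) := by rw [ht]; field_simp
  have hlt : ε / (1 + ε) < 1 := by rw [div_lt_one (by positivity)]; linarith
  have htM : t * M ≤ 1 := by nlinarith
  have hlt' : t * M ^ 2 < ε := by
    rw [htM2, div_lt_iff₀ (by positivity)]; nlinarith
  have hs : (1 + t ^ 2 * M ^ 2) * Real.exp (-(t * ε)) < 1 := by
    rw [Real.exp_neg, ← div_eq_mul_inv, div_lt_one (Real.exp_pos _)]
    calc 1 + t ^ 2 * M ^ 2 ≤ Real.exp (t ^ 2 * M ^ 2) := by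
          linarith [Real.add_one_le_exp (t ^ 2 * M ^ 2)]
      _ < Real.exp (t * ε) := by
          apply Real.exp_lt_exp.2; nlinarith
  refine ⟨Real.exp (t * M), Real.exp_pos _,
    max (1 / 2) ((1 + t ^ 2 * M ^ 2) * Real.exp (-(t * ε))), le_max_left _ _,
    max_lt (by norm_num) hs, fun f h hD hmean n x => ?_⟩
  set B := (chainsFrom r n x).filter fun l => ε * (n + 1) ≤ closeSum f x x l
  have h1 : (B.card : ℝ) * Real.exp (t * (ε * (n + 1))) ≤
      Real.exp (t * M) * (q * (1 + t ^ 2 * M ^ 2)) ^ n := by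
    refine le_trans ?_ (sum_exp_closeSum_le hq ht0.le htM hD hmean n x x)
    rw [← nsmul_eq_mul]
    refine le_trans (Finset.card_nsmul_le_sum B _ _ fun l hl => ?_)
      (Finset.sum_le_sum_of_subset_of_nonneg (Finset.filter_subset _ _)
        fun _ _ _ => (Real.exp_pos _).le)
    rw [closeSum_coboundary, add_sub_cancel_right]
    have := (Finset.mem_filter.1 hl).2
    gcongr
  calc (B.card : ℝ) = B.card * Real.exp (t * (ε * (n + 1))) * Real.exp (-(t * (ε * (n + 1)))) := by
        rw [mul_assoc, ← Real.exp_add]; simp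
    _ ≤ Real.exp (t * M) * (q * (1 + t ^ 2 * M ^ 2)) ^ n * Real.exp (-(t * ε)) ^ n := by
        rw [← Real.exp_nat_mul]
        refine mul_le_mul h1 (Real.exp_le_exp.2 ?_) (Real.exp_pos _).le (by positivity)
        nlinarith [mul_pos ht0 hε]
    _ = Real.exp (t * M) * (q * ((1 + t ^ 2 * M ^ 2) * Real.exp (-(t * ε)))) ^ n := by
        rw [mul_assoc, ← mul_pow]; ring
    _ ≤ _ := by
        gcongr
        exact le_max_right _ _

theorem exists_card_abs_closeSum_le {q : ℕ} (hq : ∀ x, (Finset.univ.filter (r x)).card = q)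
    {M ε : ℝ} (hM : 1 ≤ M) (hε : 0 < ε) :
    ∃ C : ℝ, 0 < C ∧ ∃ s : ℝ, 1 / 2 ≤ s ∧ s < 1 ∧ ∀ (f : A → A → ℝ) (h : A → ℝ),
      (∀ x y, |f x y + h y - h x| ≤ M) → (∀ x, ∑ y with r x y, (f x y + h y - h x) = 0) →
      ∀ n x, (((chainsFrom r n x).filter fun l => ε * (n + 1) ≤ |closeSum f x x l|).card : ℝ) ≤
        C * (q * s) ^ n := by
  obtain ⟨C, hC, s, hs, hs1, H⟩ := exists_card_closeSum_le hq hM hε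
  refine ⟨2 * C, by positivity, s, hs, hs1, fun f h hD hmean n x => ?_⟩
  have h1 := H f h hD hmean n x
  have h2 := H (fun u v => -f u v) (fun u => -h u)
    (fun x y => by rw [← abs_neg]; convert hD x y using 2; ring)
    (fun x => by
      rw [← neg_eq_zero, ← Finset.sum_neg_distrib, ← hmean x]
      exact Finset.sum_congr rfl fun _ _ => by ring) n x
  simp only [closeSum_neg] at h2
  simp only [le_abs, Finset.filter_or]
  have h3 := Nat.cast_le (α := ℝ).2 (Finset.card_union_le
    ((chainsFrom r n x).filter fun l => ε * (n + 1) ≤ closeSum f x x l)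
    ((chainsFrom r n x).filter fun l => ε * (n + 1) ≤ -closeSum f x x l))
  push_cast at h3
  linarith

end Chains

section Letters

variable {X : Type} [Fintype X] [DecidableEq X]

/-- Two consecutive letters that do not cancel. -/
abbrev NoCancel (x y : X × Bool) : Prop := x.1 = y.1 → x.2 = y.2

omit [Fintype X] [DecidableEq X] in
theorem noCancel_iff {x y : X × Bool} : NoCancel x y ↔ y ≠ (x.1, !x.2) := by
  obtain ⟨x, b⟩ := x
  obtain ⟨y, c⟩ := y
  simp only [NoCancel, ne_eq, Prod.mk.injEq, not_and]
  cases b <;> cases c <;> simp [eq_comm]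

theorem card_noCancel (x : X × Bool) :
    (Finset.univ.filter (NoCancel x)).card = 2 * Fintype.card X - 1 := by
  have : Finset.univ.filter (NoCancel x) = Finset.univ.erase (x.1, !x.2) := by
    ext y; simp [noCancel_iff]
  rw [this, Finset.card_erase_of_mem (Finset.mem_univ _), Finset.card_univ, Fintype.card_prod,
    Fintype.card_bool, mul_comm]

theorem sum_noCancel_indicator (x b : X × Bool) (c : ℝ) :
    (∑ y with NoCancel x y, if y = b then c else 0) = if NoCancel x b then c else 0 := by
  rw [Finset.sum_ite_eq']
  simp

/-- The solution of the Poisson equation for the frequency of the letter `a`. -/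
noncomputable def corrector (q : ℝ) (a x : X × Bool) : ℝ :=
  q ^ 2 / ((q + 1) * (q - 1)) *
    ((if x = a then 1 else 0) - (if x = (a.1, !a.2) then 1 / q else 0))

omit [Fintype X] in
theorem abs_corrector_le {q : ℝ} (hq : 3 ≤ q) (a x : X × Bool) : |corrector q a x| ≤ 2 := by
  have h1 : |(if x = a then (1 : ℝ) else 0) - (if x = (a.1, !a.2) then 1 / q else 0)| ≤ 1 := by
    have hq1 : 1 / q ≤ 1 := by rw [div_le_one] <;> linarith
    have hq0 : 0 ≤ 1 / q := by positivity
    split_ifs with h h' h'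
    · rw [abs_le]; constructor <;> linarith
    · simp
    · rw [abs_le]; constructor <;> linarith
    · simp
  have hpos : 0 < (q + 1) * (q - 1) := by nlinarith
  have h2 : |q ^ 2 / ((q + 1) * (q - 1))| ≤ 2 := by
    rw [abs_of_nonneg (by positivity), div_le_iff₀ hpos]
    nlinarith
  rw [corrector, abs_mul]
  calc _ ≤ (2 : ℝ) * 1 := mul_le_mul h2 h1 (abs_nonneg _) (by norm_num)
    _ = 2 := mul_one 2

/-- The deviation of the indicator of the letter `a` from its mean. -/
noncomputable def letterDev (q : ℝ) (a x _y : X × Bool) : ℝ :=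
  (if x = a then 1 else 0) - 1 / (q + 1)

/-- The deviation of the indicator of the pair `(a, b)` from its mean. -/
noncomputable def pairDev (q : ℝ) (a b x y : X × Bool) : ℝ :=
  (if (x, y) = (a, b) then 1 else 0) - 1 / ((q + 1) * q)

theorem sum_letterDev {q : ℝ} (hX : 2 ≤ Fintype.card X) (hq : q = 2 * Fintype.card X - 1)
    (a x : X × Bool) :
    ∑ y with NoCancel x y, (letterDev q a x y + corrector q a y - corrector q a x) = 0 := by
  have hX' : (2 : ℝ) ≤ Fintype.card X := by exact_mod_cast hX
  have hq3 : 3 ≤ q := by linarith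
  have hcard : ((Finset.univ.filter (NoCancel x)).card : ℝ) = q := by
    rw [card_noCancel, Nat.cast_sub (by omega), hq]; push_cast; ring
  have h1 : q - 1 ≠ 0 := by linarith
  have h2 : q + 1 ≠ 0 := by linarith
  have h3 : q ≠ 0 := by linarith
  have e1 : NoCancel x a ↔ x ≠ (a.1, !a.2) := by
    obtain ⟨x, b⟩ := x
    obtain ⟨y, c⟩ := a
    simp only [NoCancel, ne_eq, Prod.mk.injEq, not_and]
    cases b <;> cases c <;> simp
  have e2 : NoCancel x (a.1, !a.2) ↔ x ≠ a := by
    obtain ⟨x, b⟩ := x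
    obtain ⟨y, c⟩ := a
    simp only [NoCancel, ne_eq, Prod.mk.injEq, not_and]
    cases b <;> cases c <;> simp
  simp only [Finset.sum_sub_distrib, Finset.sum_add_distrib, letterDev, Finset.sum_const,
    nsmul_eq_mul, hcard]
  simp only [corrector, ← Finset.mul_sum, Finset.sum_sub_distrib, sum_noCancel_indicator, e1, e2]
  by_cases hxa : x = a
  · have hxa' : x ≠ (a.1, !a.2) := by
      rw [hxa]; intro h; simpa using congrArg Prod.snd h
    simp only [hxa, ne_eq, not_true_eq_false, if_true, if_false]
    rw [hxa] at hxa'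
    simp only [hxa', not_false_eq_true, if_true, if_false]
    field_simp
    ring
  · by_cases hxa' : x = (a.1, !a.2)
    · simp only [hxa', ne_eq, not_true_eq_false, if_true, if_false]
      rw [hxa'] at hxa
      simp only [hxa, not_false_eq_true, if_true, if_false]
      field_simp
      ring
    · simp only [hxa, hxa', ne_eq, not_false_eq_true, if_true, if_false]
      field_simp
      ring

theorem sum_pairDev {q : ℝ} (hX : 2 ≤ Fintype.card X) (hq : q = 2 * Fintype.card X - 1)
    {a b : X × Bool} (hab : NoCancel a b) (x : X × Bool) :
    ∑ y with NoCancel x y, (pairDev q a b x y + corrector q a y / q - corrector q a x / q) = 0 := by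
  have hX' : (2 : ℝ) ≤ Fintype.card X := by exact_mod_cast hX
  have hq3 : 3 ≤ q := by linarith
  have hcard : ((Finset.univ.filter (NoCancel x)).card : ℝ) = q := by
    rw [card_noCancel, Nat.cast_sub (by omega), hq]; push_cast; ring
  have h2 : q + 1 ≠ 0 := by linarith
  have h3 : q ≠ 0 := by linarith
  have hsum : ∑ y with NoCancel x y, pairDev q a b x y =
      ∑ y with NoCancel x y, letterDev q a x y / q := by
    simp only [pairDev, letterDev, ← Finset.sum_div, Finset.sum_sub_distrib, Finset.sum_const,
      nsmul_eq_mul, hcard, Prod.mk.injEq]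
    by_cases hxa : x = a
    · subst hxa
      simp only [true_and, sum_noCancel_indicator, if_true]
      rw [if_pos hab]
      field_simp
    · simp only [hxa, false_and, if_false, Finset.sum_const_zero]
      field_simp
  rw [Finset.sum_sub_distrib, Finset.sum_add_distrib, hsum, ← Finset.sum_add_distrib,
    ← Finset.sum_sub_distrib]
  simp only [← add_div, ← sub_div, ← Finset.sum_div]
  rw [sum_letterDev hX hq, zero_div]

theorem sum_map_ite_sub {B : Type*} [DecidableEq B] [BEq B] [LawfulBEq B] (L : List B) (b : B) (c : ℝ) :
    (L.map fun p => (if p = b then (1 : ℝ) else 0) - c).sum = L.count b - c * L.length := by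
  induction L with
  | nil => simp
  | cons p L ih =>
    rw [List.map_cons, List.sum_cons, ih, List.count_cons, List.length_cons]
    by_cases h : p = b <;> simp [h] <;> ring

omit [Fintype X] in
theorem closeSum_letterDev (q : ℝ) (a z x : X × Bool) (l : List (X × Bool)) :
    closeSum (letterDev q a) z x l = (x :: l).count a - 1 / (q + 1) * (l.length + 1) := by
  have h : ((x :: l).zip (l ++ [z])).map (fun p => letterDev q a p.1 p.2) =
      (((x :: l).zip (l ++ [z])).map Prod.fst).map
        fun p => (if p = a then (1 : ℝ) else 0) - 1 / (q + 1) := by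
    rw [List.map_map]; rfl
  rw [closeSum, h, List.map_fst_zip (by simp), sum_map_ite_sub]
  simp

omit [Fintype X] in
theorem closeSum_pairDev (q : ℝ) (a b x : X × Bool) (l : List (X × Bool)) :
    closeSum (pairDev q a b) x x l =
      ((x :: l).zip ((x :: l).rotate 1)).count (a, b) - 1 / ((q + 1) * q) * (l.length + 1) := by
  have h := sum_map_ite_sub ((x :: l).zip (l ++ [x])) (a, b) (1 / ((q + 1) * q))
  simp only [closeSum, pairDev, List.rotate_cons_succ, List.rotate_zero]
  rw [h]
  simp

end Letters

section FreeGroupWords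

variable {X : Type} [DecidableEq X]

theorem FreeGroup.norm_pow_of_isCyclicallyReduced {w : FreeGroup X}
    (hw : FreeGroup.IsCyclicallyReduced w.toWord) (n : ℕ) : (w ^ n).norm = n * w.norm := by
  rw [FreeGroup.norm, FreeGroup.toWord_pow, (hw.flatten_replicate n).isReduced.reduce_eq]
  simp [FreeGroup.norm]

theorem CyclicallyReduced.of_isCyclicallyReduced {w : FreeGroup X}
    (hw : FreeGroup.IsCyclicallyReduced w.toWord) : CyclicallyReduced w := by
  refine le_antisymm (le_csInf (Set.range_nonempty _) ?_) (Nat.sInf_le ⟨1, by simp⟩)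
  rintro _ ⟨g, rfl⟩
  by_contra! hlt
  have hpow (n : ℕ) (u : FreeGroup X) : (u ^ n).norm ≤ n * u.norm := by
    induction n with
    | zero => simp
    | succ n ih =>
      rw [pow_succ, Nat.succ_mul]
      exact (FreeGroup.norm_mul_le _ _).trans (by gcongr)
  set n := 2 * g.norm + 1
  have h1 : (w ^ n).norm ≤ g.norm + n * (g * w * g⁻¹).norm + g.norm := by
    have : w ^ n = g⁻¹ * (g * w * g⁻¹) ^ n * g := by rw [conj_pow]; group
    rw [this]
    refine (FreeGroup.norm_mul_le _ _).trans ?_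
    gcongr
    refine (FreeGroup.norm_mul_le _ _).trans ?_
    rw [FreeGroup.norm_inv_eq]
    gcongr
    exact hpow _ _
  rw [FreeGroup.norm_pow_of_isCyclicallyReduced hw] at h1
  have h2 : n * ((g * w * g⁻¹).norm + 1) ≤ n * w.norm := Nat.mul_le_mul_left _ hlt
  have : n * (g * w * g⁻¹).norm + n ≤ n * w.norm := by linarith
  omega

theorem finite_ballF (X : Type) [Finite X] [DecidableEq X] (n : ℕ) : (ballF X n).Finite :=
  ((List.finite_length_le (X × Bool) n).preimage FreeGroup.toWord_injective.injOn).subset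
    fun _ hw => hw

theorem pow_le_ncard_cyclicallyReduced [Fintype X] (hX : 2 ≤ Fintype.card X) (n : ℕ) :
    (2 * Fintype.card X - 1) ^ n ≤
      ({w : FreeGroup X | CyclicallyReduced w} ∩ ballF X (n + 2)).ncard := by
  obtain ⟨x₀⟩ : Nonempty X := Fintype.card_pos_iff.1 (by omega)
  set a : X × Bool := (x₀, true)
  have hex (b : X × Bool) : ∃ y, NoCancel b y ∧ NoCancel y a := by
    obtain ⟨y, hy⟩ := Fintype.exists_ne_of_one_lt_card (α := X) (by omega) x₀
    by_cases hb : b = (x₀, false)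
    · exact ⟨(y, true), fun h => by simp_all, fun h => by simp_all [a]⟩
    · refine ⟨a, fun h => ?_, fun _ => rfl⟩
      obtain ⟨b, c⟩ := b
      cases c <;> simp_all [a]
  choose e he he' using hex
  set g : List (X × Bool) → FreeGroup X := fun l =>
    FreeGroup.mk (a :: l ++ [e ((a :: l).getLast (List.cons_ne_nil _ _))])
  have hcyc {l : List (X × Bool)} (hl : l ∈ chainsFrom NoCancel n a) :
      FreeGroup.IsCyclicallyReduced
        (a :: l ++ [e ((a :: l).getLast (List.cons_ne_nil _ _))]) := by
    rw [FreeGroup.isCyclicallyReduced_cons_append_iff]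
    refine ⟨List.isChain_append.2 ⟨((mem_chainsFrom _).1 hl).2, List.isChain_singleton _, ?_⟩,
      he' _⟩
    intro u hu v hv
    rw [List.getLast?_eq_some_getLast (List.cons_ne_nil _ _)] at hu
    simp only [Option.mem_def, Option.some.injEq, List.head?_cons] at hu hv
    rw [← hu, ← hv]
    exact he _
  have hword {l : List (X × Bool)} (hl : l ∈ chainsFrom NoCancel n a) : (g l).toWord =
      a :: l ++ [e ((a :: l).getLast (List.cons_ne_nil _ _))] := by
    rw [FreeGroup.toWord_mk, (hcyc hl).isReduced.reduce_eq]
  have hinj : Set.InjOn g (chainsFrom NoCancel n a) := by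
    intro l hl l' hl' h
    have := congrArg FreeGroup.toWord h
    rw [hword hl, hword hl'] at this
    exact (List.cons.inj (List.append_inj_left' this rfl)).2
  rw [← card_chainsFrom (r := NoCancel) card_noCancel n a, ← Finset.card_image_of_injOn hinj,
    ← Set.ncard_coe_finset]
  refine Set.ncard_le_ncard ?_ ((finite_ballF X _).subset Set.inter_subset_right)
  intro w hw
  simp only [Finset.coe_image, Set.mem_image, Finset.mem_coe] at hw
  obtain ⟨l, hl, rfl⟩ := hw
  refine ⟨CyclicallyReduced.of_isCyclicallyReduced (hword hl ▸ hcyc hl), ?_⟩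
  change (g l).toWord.length ≤ n + 2
  rw [hword hl]
  simp [((mem_chainsFrom _).1 hl).1]

end FreeGroupWords

section Genericity

variable {X : Type} [Fintype X] [DecidableEq X]

/-- The chains `l` for which the frequencies of `a` or of `(a, b)` in the cyclic word `x :: l`
are off by at least `ε`. -/
noncomputable def badChains (q ε : ℝ) (n : ℕ) (x a b : X × Bool) : Finset (List (X × Bool)) :=
  (chainsFrom NoCancel n x).filter fun l =>
    ε * (n + 1) ≤ |closeSum (letterDev q a) x x l| ∨
      ε * (n + 1) ≤ |closeSum (pairDev q a b) x x l|

theorem exists_card_badChains_le (hX : 2 ≤ Fintype.card X) {q ε : ℝ}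
    (hq : q = 2 * Fintype.card X - 1) (hε : 0 < ε) :
    ∃ C : ℝ, 0 < C ∧ ∃ s : ℝ, 1 / 2 ≤ s ∧ s < 1 ∧ ∀ n (x a b : X × Bool), NoCancel a b →
      ((badChains q ε n x a b).card : ℝ) ≤ C * (q * s) ^ n := by
  have hX' : (2 : ℝ) ≤ Fintype.card X := by exact_mod_cast hX
  have hq3 : 3 ≤ q := by linarith
  obtain ⟨C, hC, s, hs, hs1, H⟩ :=
    exists_card_abs_closeSum_le (M := 5) (card_noCancel (X := X)) (by norm_num) hε
  have hcast : ((2 * Fintype.card X - 1 : ℕ) : ℝ) = q := by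
    rw [Nat.cast_sub (by omega), hq]; push_cast; ring
  rw [hcast] at H
  refine ⟨2 * C, by positivity, s, hs, hs1, fun n x a b hab => ?_⟩
  have hunit {p : Prop} [Decidable p] {c : ℝ} (hc : 1 ≤ c) :
      |(if p then (1 : ℝ) else 0) - 1 / c| ≤ 1 := by
    have h1 : 1 / c ≤ 1 := by rw [div_le_one] <;> linarith
    have h0 : 0 ≤ 1 / c := by positivity
    split_ifs <;> rw [abs_le] <;> constructor <;> linarith
  have hdiv (x : X × Bool) : |corrector q a x / q| ≤ 2 := by
    rw [abs_div, abs_of_pos (by linarith : 0 < q), div_le_iff₀ (by linarith)]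
    linarith [abs_corrector_le hq3 a x]
  have h1 := H (letterDev q a) (corrector q a) (fun x y => by
    have h := abs_le.1 (hunit (p := x = a) (by linarith : 1 ≤ q + 1))
    have hx := abs_le.1 (abs_corrector_le hq3 a x)
    have hy := abs_le.1 (abs_corrector_le hq3 a y)
    rw [letterDev, abs_le]
    constructor <;> linarith) (sum_letterDev hX hq a) n x
  have h2 := H (pairDev q a b) (fun x => corrector q a x / q) (fun x y => by
    have h := abs_le.1 (hunit (p := (x, y) = (a, b)) (by nlinarith : 1 ≤ (q + 1) * q))
    have hx := abs_le.1 (hdiv x)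
    have hy := abs_le.1 (hdiv y)
    rw [pairDev, abs_le]
    constructor <;> linarith) (sum_pairDev hX hq hab) n x
  rw [badChains, Finset.filter_or]
  have h3 := Nat.cast_le (α := ℝ).2 (Finset.card_union_le
    ((chainsFrom NoCancel n x).filter fun l => ε * (n + 1) ≤ |closeSum (letterDev q a) x x l|)
    ((chainsFrom NoCancel n x).filter fun l => ε * (n + 1) ≤ |closeSum (pairDev q a b) x x l|))
  push_cast at h3
  linarith

/-- The elements of length at most `n` given by bad chains. -/
noncomputable def badElements (q ε : ℝ) (n : ℕ) : Finset (FreeGroup X) :=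
  (Finset.range n).biUnion fun m =>
    (Finset.univ (α := X × Bool)).biUnion fun x =>
      (Finset.univ.filter fun p : (X × Bool) × (X × Bool) => NoCancel p.1 p.2).biUnion fun p =>
        (badChains q ε m x p.1 p.2).image fun l => FreeGroup.mk (x :: l)

theorem diff_Lset_subset (hX : 2 ≤ Fintype.card X) {q ε : ℝ}
    (hq : q = 2 * Fintype.card X - 1) (n : ℕ) :
    ({w : FreeGroup X | CyclicallyReduced w} \ Lset X ε) ∩ ballF X n ⊆
      (insert 1 (badElements q ε n) : Finset (FreeGroup X)) := by
  rintro w ⟨⟨hw, hwL⟩, hn⟩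
  rw [Finset.coe_insert, Set.mem_insert_iff, or_iff_not_imp_left]
  intro hw1
  have hX' : (2 : ℝ) ≤ Fintype.card X := by exact_mod_cast hX
  change w.toWord.length ≤ n at hn
  obtain ⟨x, l, hl⟩ : ∃ x l, w.toWord = x :: l :=
    List.exists_cons_of_ne_nil fun h => hw1 (FreeGroup.toWord_eq_nil_iff.1 h)
  have hnorm : w.norm = l.length + 1 := by simp [FreeGroup.norm, hl]
  have hbad : ¬ ∀ a b : X × Bool, b ≠ (a.1, !a.2) →
      |((w.toWord.count a : ℝ) / (w.norm : ℝ)) - 1 / (2 * (Fintype.card X : ℝ))| < ε ∧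
      |(((w.toWord.zip (w.toWord.rotate 1)).count (a, b) : ℝ) / (w.norm : ℝ)) -
        1 / (2 * (Fintype.card X : ℝ) * (2 * (Fintype.card X : ℝ) - 1))| < ε :=
    fun h => hwL ⟨hw, by omega, h⟩
  push Not at hbad
  obtain ⟨a, b, hab, hbad⟩ := hbad
  have hscale {c k : ℝ} (h : ε ≤ |c / (w.norm : ℝ) - k|) :
      ε * ((l.length : ℝ) + 1) ≤ |c - k * (l.length + 1)| := by
    have hpos : (0 : ℝ) < l.length + 1 := by positivity
    rw [hnorm] at h
    push_cast at h
    calc ε * ((l.length : ℝ) + 1) ≤ |c / (l.length + 1) - k| * (l.length + 1) := by gcongr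
      _ = |c / (l.length + 1) - k| * |(l.length : ℝ) + 1| := by rw [abs_of_pos hpos]
      _ = _ := by rw [← abs_mul]; congr 1; field_simp
  have hq1 : q + 1 = 2 * Fintype.card X := by rw [hq]; ring
  simp only [badElements, Finset.coe_biUnion, Set.mem_iUnion, Finset.coe_image, Set.mem_image,
    Finset.mem_coe, Finset.mem_range, Finset.mem_univ, Finset.mem_filter]
  refine ⟨l.length, by rw [hl] at hn; simpa using hn, x, trivial, (a, b),
    ⟨trivial, noCancel_iff.2 hab⟩, l, ?_, by rw [← hl, FreeGroup.mk_toWord]⟩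
  rw [badChains, Finset.mem_filter, mem_chainsFrom, closeSum_letterDev, closeSum_pairDev, hq1, ← hl,
    hq]
  refine ⟨⟨rfl, FreeGroup.isReduced_toWord⟩, ?_⟩
  by_cases h1 : ε ≤ |((w.toWord.count a : ℝ) / (w.norm : ℝ)) - 1 / (2 * (Fintype.card X : ℝ))|
  · exact Or.inl (hscale h1)
  · exact Or.inr (hscale (hbad (not_le.1 h1)))

theorem exists_card_badElements_le (hX : 2 ≤ Fintype.card X) {q ε : ℝ}
    (hq : q = 2 * Fintype.card X - 1) (hε : 0 < ε) :
    ∃ C : ℝ, 0 < C ∧ ∃ s : ℝ, 1 / 2 ≤ s ∧ s < 1 ∧ ∀ n,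
      ((badElements (X := X) q ε n).card : ℝ) ≤ C * (q * s) ^ n := by
  have hX' : (2 : ℝ) ≤ Fintype.card X := by exact_mod_cast hX
  have hq3 : 3 ≤ q := by linarith
  obtain ⟨C, hC, s, hs, hs1, H⟩ := exists_card_badChains_le hX hq hε
  have : Nonempty X := Fintype.card_pos_iff.1 (by omega)
  set K : ℝ := (Fintype.card (X × Bool) : ℝ) with hK
  have hK0 : 0 < K := by rw [hK]; exact_mod_cast Fintype.card_pos
  refine ⟨2 * (K * (K * K * C)), by positivity, s, hs, hs1, fun n => ?_⟩
  have hr : 3 / 2 ≤ q * s := by nlinarith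
  have hsum : ((badElements (X := X) q ε n).card : ℝ) ≤
      ∑ m ∈ Finset.range n, K * (K * K * C) * (q * s) ^ m := by
    refine (Nat.cast_le.2 Finset.card_biUnion_le).trans ?_
    rw [Nat.cast_sum]
    refine Finset.sum_le_sum fun m _ => ?_
    refine (Nat.cast_le.2 Finset.card_biUnion_le).trans ?_
    rw [Nat.cast_sum, mul_assoc, ← nsmul_eq_mul]
    refine Finset.sum_le_card_nsmul _ _ _ fun x _ => ?_
    refine (Nat.cast_le.2 Finset.card_biUnion_le).trans ?_
    rw [Nat.cast_sum, mul_assoc]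
    refine (Finset.sum_le_card_nsmul _ _ (C * (q * s) ^ m) fun p hp => ?_).trans ?_
    · exact (Nat.cast_le.2 Finset.card_image_le).trans (H m x p.1 p.2 (Finset.mem_filter.1 hp).2)
    · rw [nsmul_eq_mul]
      gcongr
      refine (Nat.cast_le.2 (Finset.card_filter_le _ _)).trans ?_
      rw [Finset.card_univ, Fintype.card_prod, Nat.cast_mul]
  refine hsum.trans ?_
  rw [← Finset.mul_sum, geom_sum_eq (by linarith)]
  have hle : ((q * s) ^ n - 1) / (q * s - 1) ≤ 2 * (q * s) ^ n := by
    have : 0 < (q * s) ^ n := by positivity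
    rw [div_le_iff₀ (by linarith)]
    nlinarith
  calc _ ≤ K * (K * K * C) * (2 * (q * s) ^ n) := by gcongr
    _ = _ := by ring

end Genericity

/-- for every ε > 0, the set L(ε) is exponentially C-generic, where C is
the set of cyclically reduced elements of F(X). -/
theorem statement16 (X : Type) [Fintype X] [DecidableEq X] (hX : 2 ≤ Fintype.card X)
    (ε : ℝ) (hε : 0 < ε) :
    ExpGeneric (Lset X ε) {w : FreeGroup X | CyclicallyReduced w} := by
  have hX' : (2 : ℝ) ≤ Fintype.card X := by exact_mod_cast hX
  obtain ⟨q, hq⟩ : ∃ q : ℝ, q = 2 * Fintype.card X - 1 := ⟨_, rfl⟩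
  have hq3 : 3 ≤ q := by linarith
  obtain ⟨C, hC, s, hs, hs1, H⟩ := exists_card_badElements_le hX hq hε
  refine ⟨(1 + C) * q ^ 2, by positivity, s, by linarith, hs1, fun n => ?_⟩
  have hr : 1 ≤ q * s := by nlinarith
  have hupper : (((({w : FreeGroup X | CyclicallyReduced w} \ Lset X ε) ∩
      ballF X n).ncard : ℕ) : ℝ) ≤ (1 + C) * (q * s) ^ n := by
    have h1 := Set.ncard_le_ncard (diff_Lset_subset (ε := ε) hX hq n) (Finset.finite_toSet _)
    rw [Set.ncard_coe_finset] at h1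
    have h2 : ((insert 1 (badElements (X := X) q ε n)).card : ℝ) ≤
        (badElements (X := X) q ε n).card + 1 := by
      exact_mod_cast Finset.card_insert_le _ _
    have h3 : (1 : ℝ) ≤ (q * s) ^ n := one_le_pow₀ hr
    have h4 := Nat.cast_le (α := ℝ).2 h1
    linarith [H n]
  have hlower : q ^ n ≤
      q ^ 2 * (({w : FreeGroup X | CyclicallyReduced w} ∩ ballF X n).ncard : ℝ) := by
    have hcast : ((2 * Fintype.card X - 1 : ℕ) : ℝ) = q := by
      rw [Nat.cast_sub (by omega), hq]; push_cast; ring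
    rcases lt_or_ge n 2 with hn | hn
    · have hone : (1 : FreeGroup X) ∈
          {w : FreeGroup X | CyclicallyReduced w} ∩ ballF X n :=
        ⟨CyclicallyReduced.of_isCyclicallyReduced (by simp), by simp [ballF]⟩
      have h1 : 1 ≤ ({w : FreeGroup X | CyclicallyReduced w} ∩ ballF X n).ncard :=
        (Set.ncard_pos ((finite_ballF X n).subset Set.inter_subset_right)).2 ⟨1, hone⟩
      have h2 : (1 : ℝ) ≤ ({w : FreeGroup X | CyclicallyReduced w} ∩ ballF X n).ncard := by
        exact_mod_cast h1
      have h3 : q ^ n ≤ q ^ 2 := pow_le_pow_right₀ (by linarith) hn.le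
      nlinarith [sq_nonneg q]
    · obtain ⟨m, rfl⟩ := Nat.exists_eq_add_of_le' hn
      have h := Nat.cast_le (α := ℝ).2 (pow_le_ncard_cyclicallyReduced hX m)
      rw [Nat.cast_pow, hcast] at h
      rw [pow_add, mul_comm]
      gcongr
  calc _ ≤ (1 + C) * (q * s) ^ n := hupper
    _ = (1 + C) * s ^ n * q ^ n := by rw [mul_pow]; ring
    _ ≤ (1 + C) * s ^ n * (q ^ 2 *
        (({w : FreeGroup X | CyclicallyReduced w} ∩ ballF X n).ncard : ℝ)) := by
      have : 0 ≤ s := by linarith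
      gcongr
    _ = _ := by ring
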